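/- Let k ≥ 0 and r = k + 1, and suppose a_0 ≡ 0 and a_2 is (k+2)-times continuously differentiable with a_2(x) ≥ a_min > 0 on [a,b]. There exists a constant C > 0, independent of the partition, such that for every partition a = x_1 < … < x_N = b, if u is (k+3)-times continuously differentiable on [a,b], solves −(a_2 u′)′ = f on (a,b) with u(a) = 0, u′(b) = 0, and u_h ∈ S_h is the weak finite element solution with nodal values u_h^i, then the superconvergence estimate max_{1≤i≤N} |u_h^i − u(x_i)| ≤ C h^{k+2} ‖u‖_{k+3} holds. -/

import Mathlib

open MeasureTheory Set

noncomputable section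

/-- `p` is the discrete weak derivative of order `r` of the weak function
`(v0, vl, vr)` on the interval `(c, d)`: it is a polynomial of degree at most `r`
satisfying `∫ p q = -∫ v0 q' + vr q(d) - vl q(c)` for all polynomials `q` of
degree at most `r`. -/
def IsWeakDeriv (r : ℕ) (c d : ℝ) (v0 : ℝ → ℝ) (vl vr : ℝ) (p : Polynomial ℝ) : Prop :=
  p.degree ≤ (r : WithBot ℕ) ∧ ∀ q : Polynomial ℝ, q.degree ≤ (r : WithBot ℕ) →
    (∫ t in c..d, p.eval t * q.eval t) =
      -(∫ t in c..d, v0 t * q.derivative.eval t) + vr * q.eval d - vl * q.eval c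

/-- `p` is the L²(c,d)-orthogonal projection of `g` onto polynomials of degree at most `l`. -/
def IsL2Proj (l : ℕ) (c d : ℝ) (g : ℝ → ℝ) (p : Polynomial ℝ) : Prop :=
  p.degree ≤ (l : WithBot ℕ) ∧ ∀ q : Polynomial ℝ, q.degree ≤ (l : WithBot ℕ) →
    (∫ t in c..d, (g t - p.eval t) * q.eval t) = 0

/-- `x 0 = a < x 1 < ⋯ < x (N-1) = b` is a partition of `(a,b)`. -/
def IsPartition (N : ℕ) (a b : ℝ) (x : ℕ → ℝ) : Prop :=
  2 ≤ N ∧ x 0 = a ∧ x (N - 1) = b ∧ ∀ i < N - 1, x i < x (i + 1)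

/-- Membership in the weak finite element space `S_h`: on each of the `N - 1` elements the
interior component is a polynomial of degree at most `k`, the nodal values are single
valued, and the nodal value at the left endpoint vanishes. -/
def MemSh (k N : ℕ) (v0 : ℕ → Polynomial ℝ) (vn : ℕ → ℝ) : Prop :=
  (∀ i < N - 1, (v0 i).degree ≤ (k : WithBot ℕ)) ∧ vn 0 = 0

/-- `D i` is the discrete weak derivative of order `r` of the weak finite element function
`(v0, vn)` on the `i`-th element `(x i, x (i+1))`. -/
def IsWeakDerivFam (r N : ℕ) (x : ℕ → ℝ) (v0 : ℕ → Polynomial ℝ) (vn : ℕ → ℝ)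
    (D : ℕ → Polynomial ℝ) : Prop :=
  ∀ i < N - 1, IsWeakDeriv r (x i) (x (i + 1)) (fun t => (v0 i).eval t) (vn i) (vn (i + 1)) (D i)

/-- `(u0, un)` with discrete weak derivatives `Du` is a weak finite element solution:
it belongs to `S_h` and satisfies
`(a2 d_w u_h, d_w v)_h + (a0 u_h⁰, v⁰) = (f, v⁰)` for all `v ∈ S_h`. -/
def IsWFESol (k r N : ℕ) (x : ℕ → ℝ) (a2 a0 f : ℝ → ℝ)
    (u0 : ℕ → Polynomial ℝ) (un : ℕ → ℝ) (Du : ℕ → Polynomial ℝ) : Prop :=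
  MemSh k N u0 un ∧ IsWeakDerivFam r N x u0 un Du ∧
  ∀ (v0 : ℕ → Polynomial ℝ) (vn : ℕ → ℝ) (Dv : ℕ → Polynomial ℝ),
    MemSh k N v0 vn → IsWeakDerivFam r N x v0 vn Dv →
    ((∑ i ∈ Finset.range (N - 1), ∫ t in x i..x (i + 1), a2 t * (Du i).eval t * (Dv i).eval t)
      + ∑ i ∈ Finset.range (N - 1), ∫ t in x i..x (i + 1), a0 t * (u0 i).eval t * (v0 i).eval t)
      = ∑ i ∈ Finset.range (N - 1), ∫ t in x i..x (i + 1), f t * (v0 i).eval t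

/-- The Sobolev norm `‖u‖_m = (∑_{j=0}^m ∫_a^b |u^{(j)}|² dx)^{1/2}` of an `m`-times
continuously differentiable function on `[a,b]`. -/
def sobNorm (m : ℕ) (a b : ℝ) (u : ℝ → ℝ) : ℝ :=
  Real.sqrt (∑ j ∈ Finset.range (m + 1),
    ∫ t in a..b, (iteratedDerivWithin j u (Set.Icc a b) t) ^ 2)

/-- `u` solves the two-point boundary value problem
`-(a2 u')' + a0 u = f` on `(a,b)`, `u(a) = 0`, `u'(b) = 0`. -/
def SolvesBVP (a b : ℝ) (a2 a0 f u : ℝ → ℝ) : Prop :=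
  (∀ x ∈ Set.Ioo a b,
    -(derivWithin (fun t => a2 t * derivWithin u (Set.Icc a b) t) (Set.Icc a b) x)
      + a0 x * u x = f x) ∧
  u a = 0 ∧ derivWithin u (Set.Icc a b) b = 0

section Helpers

lemma wf_ii {c d : ℝ} (hcd : c ≤ d) {g : ℝ → ℝ} (hg : ContinuousOn g (Icc c d)) :
    IntervalIntegrable g volume c d :=
  hg.intervalIntegrable_of_Icc hcd

lemma wf_iim {c d : ℝ} (hcd : c ≤ d) {f g : ℝ → ℝ} (hf : ContinuousOn f (Icc c d))
    (hg : ContinuousOn g (Icc c d)) : IntervalIntegrable (fun t => f t * g t) volume c d :=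
  wf_ii hcd (hf.mul hg)

lemma wf_pc (p : Polynomial ℝ) (s : Set ℝ) : ContinuousOn (fun t => p.eval t) s :=
  p.continuous.continuousOn

lemma wf_degree_iff (k : ℕ) (p : Polynomial ℝ) :
    p.degree ≤ (k : WithBot ℕ) ↔ p ∈ Polynomial.degreeLT ℝ (k + 1) := by
  rw [Polynomial.mem_degreeLT, ← Polynomial.natDegree_le_iff_degree_le,
    Polynomial.degree_lt_iff_coeff_zero, Polynomial.natDegree_le_iff_coeff_eq_zero]
  rfl

lemma wf_exists_proj (k : ℕ) {c d : ℝ} (hcd : c < d) {g : ℝ → ℝ}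
    (hg : ContinuousOn g (Icc c d)) : ∃ p, IsL2Proj k c d g p := by
  let W := Polynomial.degreeLT ℝ (k + 1)
  have : FiniteDimensional ℝ W :=
    Module.Finite.equiv (Polynomial.degreeLTEquiv ℝ (k + 1)).symm
  have hle := hcd.le
  let L : (φ : ℝ → ℝ) → ContinuousOn φ (Icc c d) → Module.Dual ℝ W := fun φ hφ =>
    { toFun := fun q => ∫ t in c..d, φ t * (q : Polynomial ℝ).eval t
      map_add' := by
        intro q r
        simp only [Submodule.coe_add, Polynomial.eval_add, mul_add]
        exact intervalIntegral.integral_add (wf_ii hle (hφ.mul (wf_pc _ _)))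
          (wf_ii hle (hφ.mul (wf_pc _ _)))
      map_smul' := by
        intro m q
        simp only [Submodule.coe_smul, Polynomial.eval_smul, smul_eq_mul, RingHom.id_apply]
        rw [← intervalIntegral.integral_const_mul]
        congr 1; ext t; ring }
  let B : W →ₗ[ℝ] Module.Dual ℝ W :=
    { toFun := fun p => L (fun t => (p : Polynomial ℝ).eval t) (wf_pc _ _)
      map_add' := by
        intro p q
        ext r
        change (∫ t in c..d, ((p + q : W) : Polynomial ℝ).eval t * (r : Polynomial ℝ).eval t)
          = (∫ t in c..d, (p : Polynomial ℝ).eval t * (r : Polynomial ℝ).eval t)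
            + (∫ t in c..d, (q : Polynomial ℝ).eval t * (r : Polynomial ℝ).eval t)
        rw [← intervalIntegral.integral_add (wf_iim hle (wf_pc _ _) (wf_pc _ _))
          (wf_iim hle (wf_pc _ _) (wf_pc _ _))]
        congr 1; ext t
        simp only [Submodule.coe_add, Polynomial.eval_add]; ring
      map_smul' := by
        intro m q
        ext r
        change (∫ t in c..d, ((m • q : W) : Polynomial ℝ).eval t * (r : Polynomial ℝ).eval t)
          = m * (∫ t in c..d, (q : Polynomial ℝ).eval t * (r : Polynomial ℝ).eval t)
        rw [← intervalIntegral.integral_const_mul]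
        congr 1; ext t
        simp only [Submodule.coe_smul, Polynomial.eval_smul, smul_eq_mul]; ring }
  have hinj : Function.Injective B := by
    rw [← LinearMap.ker_eq_bot, LinearMap.ker_eq_bot']
    intro p hp
    have h0 : (∫ t in c..d, (p : Polynomial ℝ).eval t * (p : Polynomial ℝ).eval t) = 0 := by
      have := congrArg (fun (l : Module.Dual ℝ W) => l p) hp
      exact this
    by_contra hne
    have hne' : (p : Polynomial ℝ) ≠ 0 := fun h => hne (Subtype.ext h)
    have hz : ∃ t ∈ Icc c d, 0 < (p : Polynomial ℝ).eval t * (p : Polynomial ℝ).eval t := by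
      by_contra hcon
      push Not at hcon
      apply hne'
      apply Polynomial.eq_zero_of_infinite_isRoot
      refine (Set.Icc_infinite hcd).mono ?_
      intro t ht
      have := hcon t ht
      have h2 : (p : Polynomial ℝ).eval t * (p : Polynomial ℝ).eval t = 0 :=
        le_antisymm this (mul_self_nonneg _)
      exact mul_self_eq_zero.1 h2
    have := intervalIntegral.integral_pos hcd ((wf_pc (p : Polynomial ℝ) _).mul (wf_pc _ _))
      (fun t _ => mul_self_nonneg _) hz
    exact absurd h0 this.ne'
  have hsurj : Function.Surjective B :=
    (LinearMap.injective_iff_surjective_of_finrank_eq_finrank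
      (Subspace.dual_finrank_eq (K := ℝ) (V := W)).symm).1 hinj
  obtain ⟨p, hp⟩ := hsurj (L g hg)
  refine ⟨p, (wf_degree_iff k _).2 p.2, fun q hq => ?_⟩
  have h1 := congrArg (fun (l : Module.Dual ℝ W) => l ⟨q, (wf_degree_iff k _).1 hq⟩) hp
  have h2 : (∫ t in c..d, (p : Polynomial ℝ).eval t * q.eval t) = ∫ t in c..d, g t * q.eval t := h1
  simp only [sub_mul]
  rw [intervalIntegral.integral_sub (wf_iim hle hg (wf_pc _ _))
    (wf_iim hle (wf_pc _ _) (wf_pc _ _)), h2, sub_self]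

lemma wf_antideriv (n : ℕ) (g : Polynomial ℝ) (hg : g.degree ≤ (n : WithBot ℕ)) (c v : ℝ) :
    ∃ P : Polynomial ℝ, P.degree ≤ ((n + 1 : ℕ) : WithBot ℕ) ∧ P.derivative = g ∧
      P.eval c = v := by
  let Q : Polynomial ℝ := ∑ i ∈ Finset.range (n + 1),
    Polynomial.C (g.coeff i / ((i : ℝ) + 1)) * Polynomial.X ^ (i + 1)
  have hQd : Q.degree ≤ ((n + 1 : ℕ) : WithBot ℕ) := by
    refine (Polynomial.degree_sum_le _ _).trans (Finset.sup_le fun i hi => ?_)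
    refine (Polynomial.degree_C_mul_X_pow_le _ _).trans ?_
    have := Finset.mem_range.1 hi
    exact_mod_cast this
  have hQ : Q.derivative = g := by
    conv_rhs => rw [g.as_sum_range_C_mul_X_pow'
      (Nat.lt_succ_of_le (Polynomial.natDegree_le_iff_degree_le.2 hg))]
    simp only [Q, Polynomial.derivative_sum]
    refine Finset.sum_congr rfl fun i _ => ?_
    rw [Polynomial.derivative_C_mul_X_pow]
    congr 2
    push_cast
    have : (i : ℝ) + 1 ≠ 0 := by positivity
    field_simp
  refine ⟨Q + Polynomial.C (v - Q.eval c), ?_, ?_, ?_⟩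
  · refine (Polynomial.degree_add_le _ _).trans (max_le hQd ?_)
    exact Polynomial.degree_C_le.trans (by exact_mod_cast Nat.zero_le _)
  · simp [hQ]
  · simp

/-- Cauchy-Schwarz. -/
lemma wf_cs {c d : ℝ} (hcd : c < d) {g : ℝ → ℝ} (hg : ContinuousOn g (Icc c d)) :
    (∫ t in c..d, |g t|) ^ 2 ≤ (d - c) * ∫ t in c..d, (g t) ^ 2 := by
  have hle := hcd.le
  have hH : 0 < d - c := sub_pos.2 hcd
  set I := ∫ t in c..d, |g t| with hI
  set J := ∫ t in c..d, (g t) ^ 2 with hJ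
  have h1 : 0 ≤ ∫ t in c..d, (|g t| - I / (d - c)) ^ 2 :=
    intervalIntegral.integral_nonneg hle fun t _ => sq_nonneg _
  have h2 : (∫ t in c..d, (|g t| - I / (d - c)) ^ 2)
      = J - 2 * (I / (d - c)) * I + (d - c) * (I / (d - c)) ^ 2 := by
    have : ∀ t, (|g t| - I / (d - c)) ^ 2
        = (g t) ^ 2 - 2 * (I / (d - c)) * |g t| + (I / (d - c)) ^ 2 := by
      intro t; rw [sub_sq, sq_abs]; ring
    simp only [this]
    rw [intervalIntegral.integral_add, intervalIntegral.integral_sub,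
      intervalIntegral.integral_const_mul, intervalIntegral.integral_const, smul_eq_mul]
    · exact wf_ii hle (hg.pow 2)
    · exact wf_ii hle (hg.abs.const_smul (2 * (I / (d - c))))
    · exact wf_ii hle ((hg.pow 2).sub (hg.abs.const_smul (2 * (I / (d - c)))))
    · exact intervalIntegrable_const
  rw [h2] at h1
  have h3 : J - 2 * (I / (d - c)) * I + (d - c) * (I / (d - c)) ^ 2 = J - I ^ 2 / (d - c) := by
    field_simp; ring
  rw [h3, sub_nonneg, div_le_iff₀ hH] at h1
  linarith

lemma wf_cs_bound {c d : ℝ} (hcd : c < d) {g : ℝ → ℝ} (hg : ContinuousOn g (Icc c d))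
    {M : ℝ} (hM : 0 ≤ M) (h : ∫ t in c..d, (g t) ^ 2 ≤ (d - c) * M ^ 2) :
    ∫ t in c..d, |g t| ≤ (d - c) * M := by
  have hH : 0 < d - c := sub_pos.2 hcd
  refine abs_le_of_sq_le_sq' ?_ (by positivity) |>.2
  calc _ ≤ _ := wf_cs hcd hg
    _ ≤ (d - c) * ((d - c) * M ^ 2) := by gcongr
    _ = _ := by ring

/-- FTC on subintervals. -/
lemma wf_ftc {c d t : ℝ} (ht : t ∈ Icc c d) {F G : ℝ → ℝ}
    (hF : ∀ y ∈ Icc c d, HasDerivWithinAt F (G y) (Icc c d) y)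
    (hG : ContinuousOn G (Icc c d)) : ∫ y in c..t, G y = F t - F c := by
  have hsub : Icc c t ⊆ Icc c d := Icc_subset_Icc_right ht.2
  refine intervalIntegral.integral_eq_sub_of_hasDerivAt_of_le ht.1 ?_ ?_ ?_
  · exact fun y hy => ((hF y (hsub hy)).continuousWithinAt).mono hsub
  · intro y hy
    exact (hF y (hsub (Ioo_subset_Icc_self hy))).hasDerivAt
      (Icc_mem_nhds hy.1 (hy.2.trans_le ht.2))
  · exact wf_ii ht.1 (hG.mono hsub)

lemma wf_diff_le {c d t : ℝ} (ht : t ∈ Icc c d) {F G : ℝ → ℝ}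
    (hF : ∀ y ∈ Icc c d, HasDerivWithinAt F (G y) (Icc c d) y)
    (hG : ContinuousOn G (Icc c d)) : |F t - F c| ≤ ∫ y in c..d, |G y| := by
  rw [← wf_ftc ht hF hG]
  refine (intervalIntegral.abs_integral_le_integral_abs ht.1).trans ?_
  refine intervalIntegral.integral_mono_interval le_rfl ht.1 ht.2 ?_ (wf_ii (ht.1.trans ht.2) hG.abs)
  exact Filter.Eventually.of_forall fun y => abs_nonneg _

lemma wf_taylor {c d : ℝ} (hcd : c < d) (n : ℕ) : ∀ (F : ℕ → ℝ → ℝ),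
    (∀ m ≤ n, ∀ y ∈ Icc c d, HasDerivWithinAt (F m) (F (m + 1) y) (Icc c d) y) →
    ContinuousOn (F (n + 1)) (Icc c d) →
    ∃ s : Polynomial ℝ, s.degree ≤ (n : WithBot ℕ) ∧ ∀ t ∈ Icc c d,
      |F 0 t - s.eval t| ≤ (d - c) ^ n * ∫ y in c..d, |F (n + 1) y| := by
  have hH : 0 < d - c := sub_pos.2 hcd
  induction n with
  | zero =>
    intro F hF hc
    refine ⟨Polynomial.C (F 0 c), Polynomial.degree_C_le, fun t ht => ?_⟩
    simpa using wf_diff_le ht (hF 0 le_rfl) hc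
  | succ n ih =>
    intro F hF hc
    obtain ⟨s, hs, hst⟩ := ih (fun m => F (m + 1)) (fun m hm => hF (m + 1) (by omega)) hc
    obtain ⟨P, hP, hPd, hPc⟩ := wf_antideriv n s hs c (F 0 c)
    refine ⟨P, hP, fun t ht => ?_⟩
    have hcont : ContinuousOn (F 1) (Icc c d) := fun y hy =>
      (hF 1 (by omega) y hy).continuousWithinAt
    have hG : ContinuousOn (fun y => F 1 y - s.eval y) (Icc c d) := hcont.sub (wf_pc _ _)
    have h1 := wf_diff_le ht (F := fun y => F 0 y - P.eval y) (G := fun y => F 1 y - s.eval y)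
      (fun y hy => (hF 0 (by omega) y hy).sub
        (by have := (P.hasDerivAt y).hasDerivWithinAt (s := Icc c d); rwa [hPd] at this)) hG
    simp only [hPc, sub_self, sub_zero] at h1
    refine h1.trans ?_
    have h2 := intervalIntegral.integral_mono_on hcd.le (wf_ii hcd.le hG.abs)
      (intervalIntegrable_const (c := (d - c) ^ n * ∫ y in c..d, |F (n + 1 + 1) y|))
      (fun t ht => hst t ht)
    refine h2.trans ?_
    rw [intervalIntegral.integral_const, smul_eq_mul, pow_succ]
    apply le_of_eq; ring

/-- Local flux approximation. -/
lemma wf_flux {c d : ℝ} (hcd : c < d) (k : ℕ) (p F : ℝ → ℝ) (P q T : Polynomial ℝ) {M : ℝ}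
    (hp : ∀ y ∈ Icc c d, HasDerivWithinAt p (F y) (Icc c d) y)
    (hF : ContinuousOn F (Icc c d)) (hP : IsL2Proj k c d F P)
    (hq : q.derivative = P) (hqc : q.eval c = p c) (hT : T.degree ≤ (k : WithBot ℕ))
    (hM : 0 ≤ M) (hTM : ∀ t ∈ Icc c d, |F t - T.eval t| ≤ M) :
    ∀ t ∈ Icc c d, |q.eval t - p t| ≤ (d - c) * M := by
  have hle := hcd.le
  have hFP : ContinuousOn (fun y => F y - P.eval y) (Icc c d) := hF.sub (wf_pc _ _)
  have hPT : (P - T).degree ≤ (k : WithBot ℕ) :=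
    (Polynomial.degree_sub_le _ _).trans (max_le hP.1 hT)
  have h0 := hP.2 (P - T) hPT
  have hcs : ∫ t in c..d, (F t - P.eval t) ^ 2 ≤ (d - c) * M ^ 2 := by
    have hI1 : IntervalIntegrable (fun t => (F t - P.eval t) ^ 2) volume c d :=
      wf_ii hle (hFP.pow 2)
    have hI2 : IntervalIntegrable (fun t => (F t - P.eval t) * (P - T).eval t) volume c d :=
      wf_ii hle (hFP.mul (wf_pc _ _))
    have h1 : ∫ t in c..d, ((F t - P.eval t) ^ 2 + 2 * ((F t - P.eval t) * (P - T).eval t))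
        ≤ ∫ t in c..d, M ^ 2 := by
      refine intervalIntegral.integral_mono_on hle (hI1.add (hI2.const_mul 2))
        intervalIntegrable_const fun t ht => ?_
      have h2 := sq_le_sq' (abs_le.1 (hTM t ht)).1 (abs_le.1 (hTM t ht)).2
      have h3 : (P - T).eval t = P.eval t - T.eval t := by simp
      rw [h3]
      nlinarith [sq_nonneg (P.eval t - T.eval t)]
    rw [intervalIntegral.integral_add hI1 (hI2.const_mul 2), intervalIntegral.integral_const_mul,
      h0, intervalIntegral.integral_const, smul_eq_mul] at h1
    linarith
  intro t ht
  have h1 := wf_diff_le ht (F := fun y => p y - q.eval y) (G := fun y => F y - P.eval y)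
      (fun y hy => (hp y hy).sub
        (by have := (q.hasDerivAt y).hasDerivWithinAt (s := Icc c d); rwa [hq] at this)) hFP
  simp only [hqc, sub_self, sub_zero] at h1
  rw [abs_sub_comm]
  exact h1.trans (wf_cs_bound hcd hFP hM hcs)

lemma wf_local {c d amin A M1 M2 : ℝ} (hcd : c < d) (hamin : 0 < amin) (a2 w : ℝ → ℝ)
    (D s q : Polynomial ℝ) (ha2 : ContinuousOn a2 (Icc c d)) (hw : ContinuousOn w (Icc c d))
    (hlb : ∀ t ∈ Icc c d, amin ≤ a2 t) (hub : ∀ t ∈ Icc c d, a2 t ≤ A)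
    (hM1 : 0 ≤ M1) (hM2 : 0 ≤ M2)
    (hq : ∀ t ∈ Icc c d, |q.eval t - a2 t * w t| ≤ M1)
    (hs : ∀ t ∈ Icc c d, |w t - s.eval t| ≤ M2)
    (horth : ∫ t in c..d, (a2 t * D.eval t - q.eval t) * (D - s).eval t = 0) :
    |∫ t in c..d, (D.eval t - w t)| ≤ (d - c) * ((M1 + A * M2) / amin + M2) := by
  have hle := hcd.le
  have hA : 0 ≤ A := hamin.le.trans ((hlb c (left_mem_Icc.2 hle)).trans (hub c (left_mem_Icc.2 hle)))
  set M := M1 + A * M2 with hMdef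
  have hM : 0 ≤ M := by positivity
  have he : ContinuousOn (fun t => (D - s).eval t) (Icc c d) := wf_pc _ _
  have hI1 : IntervalIntegrable (fun t => (a2 t * D.eval t - q.eval t) * (D - s).eval t)
      volume c d := wf_ii hle (((ha2.mul (wf_pc _ _)).sub (wf_pc _ _)).mul he)
  have hI2 : IntervalIntegrable (fun t => ((D - s).eval t) ^ 2) volume c d :=
    wf_ii hle (he.pow 2)
  have hpt : ∀ t ∈ Icc c d, (amin / 2) * ((D - s).eval t) ^ 2
      ≤ (a2 t * D.eval t - q.eval t) * (D - s).eval t + M ^ 2 / (2 * amin) := by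
    intro t ht
    have e1 : (D - s).eval t = D.eval t - s.eval t := by simp
    have h1 := hq t ht
    have h2 := hs t ht
    have h3 := hlb t ht
    have h4 := hub t ht
    have h5 : |q.eval t - a2 t * s.eval t| ≤ M := by
      have : q.eval t - a2 t * s.eval t
        = (q.eval t - a2 t * w t) + a2 t * (w t - s.eval t) := by ring
      rw [this]
      refine (abs_add_le _ _).trans (add_le_add h1 ?_)
      rw [abs_mul, abs_of_nonneg (hamin.le.trans h3)]
      gcongr
    set e := (D - s).eval t with hedef
    have h6 : (q.eval t - a2 t * s.eval t) * e ≤ (amin / 2) * e ^ 2 + M ^ 2 / (2 * amin) := by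
      have h7 : (q.eval t - a2 t * s.eval t) * e ≤ M * |e| := by
        refine (le_abs_self _).trans ?_
        rw [abs_mul]; gcongr
      have h8 : (amin / 2) * e ^ 2 + M ^ 2 / (2 * amin) - M * |e|
          = (amin * |e| - M) ^ 2 / (2 * amin) := by
        rw [← sq_abs e]; field_simp; ring
      have h9 : 0 ≤ (amin * |e| - M) ^ 2 / (2 * amin) := by positivity
      linarith
    have h10 : a2 t * e ^ 2 = (a2 t * D.eval t - q.eval t) * e
        + (q.eval t - a2 t * s.eval t) * e := by rw [e1]; ring
    have h11 : amin * e ^ 2 ≤ a2 t * e ^ 2 := by gcongr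
    linarith
  have hint := intervalIntegral.integral_mono_on hle (hI2.const_mul (amin / 2))
    (hI1.add intervalIntegrable_const) hpt
  rw [intervalIntegral.integral_add hI1 intervalIntegrable_const, horth,
    intervalIntegral.integral_const_mul, intervalIntegral.integral_const, smul_eq_mul] at hint
  have hsq : ∫ t in c..d, ((D - s).eval t) ^ 2 ≤ (d - c) * (M / amin) ^ 2 := by
    have : (d - c) * (M / amin) ^ 2 = (2 / amin) * (0 + (d - c) * (M ^ 2 / (2 * amin))) := by
      field_simp; ring
    rw [this]
    calc _ = (2 / amin) * (amin / 2 * ∫ t in c..d, ((D - s).eval t) ^ 2) := by field_simp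
      _ ≤ _ := by gcongr
  have hl1 := wf_cs_bound hcd he (by positivity : 0 ≤ M / amin) hsq
  have hsplit : ∫ t in c..d, |D.eval t - w t| ≤ ∫ t in c..d, (|(D - s).eval t| + M2) := by
    refine intervalIntegral.integral_mono_on hle (wf_ii hle ((wf_pc _ _).sub hw).abs)
      ((wf_ii hle he.abs).add intervalIntegrable_const) fun t ht => ?_
    have e1 : D.eval t - w t = (D - s).eval t + -(w t - s.eval t) := by simp
    rw [e1]
    refine (abs_add_le _ _).trans ?_
    rw [abs_neg]
    gcongr
    exact hs t ht
  rw [intervalIntegral.integral_add (wf_ii hle he.abs) intervalIntegrable_const,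
    intervalIntegral.integral_const, smul_eq_mul] at hsplit
  refine (intervalIntegral.abs_integral_le_integral_abs hle).trans (hsplit.trans ?_)
  rw [mul_add]
  gcongr

end Helpers

section Helpers2

lemma wf_mono {N : ℕ} {a b : ℝ} {x : ℕ → ℝ} (hx : IsPartition N a b x) :
    ∀ j, j ≤ N - 1 → ∀ i ≤ j, x i ≤ x j := by
  intro j
  induction j with
  | zero => intro _ i hi; rw [Nat.le_zero.1 hi]
  | succ j ih =>
    intro hj i hi
    rcases Nat.lt_or_eq_of_le hi with h | h
    · exact (ih (by omega) i (by omega)).trans (hx.2.2.2 j (by omega)).le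
    · rw [h]

lemma wf_subset {N : ℕ} {a b : ℝ} {x : ℕ → ℝ} (hx : IsPartition N a b x) {i : ℕ}
    (hi : i < N - 1) : Icc (x i) (x (i + 1)) ⊆ Icc a b := by
  have h1 := wf_mono hx i (by omega) 0 (by omega)
  have h2 := wf_mono hx (N - 1) le_rfl (i + 1) (by omega)
  rw [hx.2.1] at h1
  rw [hx.2.2.1] at h2
  exact Icc_subset_Icc h1 h2

lemma wf_parts (V q : Polynomial ℝ) (c d : ℝ) :
    (∫ t in c..d, V.derivative.eval t * q.eval t) =
      -(∫ t in c..d, V.eval t * q.derivative.eval t) + V.eval d * q.eval d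
        - V.eval c * q.eval c := by
  have h1 : (∫ t in c..d, (V.derivative.eval t * q.eval t + V.eval t * q.derivative.eval t))
      = (V * q).eval d - (V * q).eval c := by
    rw [← intervalIntegral.integral_eq_sub_of_hasDerivAt (fun t _ => (V * q).hasDerivAt t)
      (Polynomial.continuous _).continuousOn.intervalIntegrable]
    congr 1; ext t
    simp [Polynomial.derivative_mul]
  rw [intervalIntegral.integral_add] at h1
  · simp only [Polynomial.eval_mul] at h1
    linarith
  · exact (V.derivative.continuous.mul q.continuous).intervalIntegrable _ _
  · exact (V.continuous.mul q.derivative.continuous).intervalIntegrable _ _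

lemma wf_orth {k N : ℕ} {a b : ℝ} {x : ℕ → ℝ} (hx : IsPartition N a b x) {a2 f p F : ℝ → ℝ}
    (ha2 : ContinuousOn a2 (Icc a b))
    (hp : ∀ y ∈ Icc a b, HasDerivWithinAt p (F y) (Icc a b) y)
    (hF : ContinuousOn F (Icc a b)) (hf : ∀ y ∈ Ioo a b, f y = -F y) (hpb : p b = 0)
    {u0 : ℕ → Polynomial ℝ} {un : ℕ → ℝ} {Du : ℕ → Polynomial ℝ}
    (hsol : IsWFESol k (k + 1) N x a2 (fun _ => 0) f u0 un Du)
    {P q : ℕ → Polynomial ℝ} (hP : ∀ i < N - 1, IsL2Proj k (x i) (x (i + 1)) F (P i))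
    (hqd : ∀ i < N - 1, (q i).degree ≤ ((k + 1 : ℕ) : WithBot ℕ))
    (hq : ∀ i < N - 1, (q i).derivative = P i) (hqx : ∀ i < N - 1, (q i).eval (x i) = p (x i))
    (g : ℕ → Polynomial ℝ) (hg : ∀ i, (g i).degree ≤ ((k + 1 : ℕ) : WithBot ℕ)) :
    ∑ i ∈ Finset.range (N - 1), ∫ t in x i..x (i + 1),
      (a2 t * (Du i).eval t - (q i).eval t) * (g i).eval t = 0 := by
  let vn : ℕ → ℝ := fun i => ∑ j ∈ Finset.range i, ∫ t in x j..x (j + 1), (g j).eval t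
  have hV := fun i => wf_antideriv (k + 1) (g i) (hg i) (x i) (vn i)
  choose V hVd hVg hVx using hV
  have hex : ∀ i, ∃ w : Polynomial ℝ, i < N - 1 →
      IsL2Proj k (x i) (x (i + 1)) (fun t => (V i).eval t) w := by
    intro i
    by_cases hi : i < N - 1
    · obtain ⟨w, hw⟩ := wf_exists_proj k (hx.2.2.2 i hi) (wf_pc (V i) _)
      exact ⟨w, fun _ => hw⟩
    · exact ⟨0, fun h => absurd h hi⟩
  choose v0 hv0 using hex
  have hVx1 : ∀ i, (V i).eval (x (i + 1)) = vn (i + 1) := by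
    intro i
    have h1 := wf_parts (V i) 1 (x i) (x (i + 1))
    simp only [hVg, Polynomial.eval_one, Polynomial.derivative_one, Polynomial.eval_zero, mul_zero,
      mul_one, intervalIntegral.integral_zero, hVx] at h1
    simp only [vn, Finset.sum_range_succ] at h1 ⊢
    linarith
  have hmem : MemSh k N v0 vn := ⟨fun i hi => (hv0 i hi).1, by simp [vn]⟩
  have hDv : IsWeakDerivFam (k + 1) N x v0 vn g := by
    intro i hi
    refine ⟨hg i, fun r hr => ?_⟩
    have h1 := wf_parts (V i) r (x i) (x (i + 1))
    rw [hVg, hVx, hVx1] at h1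
    have hr' : r.derivative.degree ≤ (k : WithBot ℕ) := by
      rw [← Polynomial.natDegree_le_iff_degree_le] at hr ⊢
      have := Polynomial.natDegree_derivative_le r
      omega
    have h2 := (hv0 i hi).2 _ hr'
    simp only [sub_mul] at h2
    have hle := (hx.2.2.2 i hi).le
    rw [intervalIntegral.integral_sub (wf_iim hle (wf_pc _ _) (wf_pc _ _))
      (wf_iim hle (wf_pc _ _) (wf_pc _ _))] at h2
    rw [h1]
    linarith
  have hmain := hsol.2.2 v0 vn g hmem hDv
  simp only [zero_mul, intervalIntegral.integral_zero, Finset.sum_const_zero, add_zero] at hmain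
  have hloc : ∀ i ∈ Finset.range (N - 1), (∫ t in x i..x (i + 1), f t * (v0 i).eval t)
      = (∫ t in x i..x (i + 1), (g i).eval t * (q i).eval t)
        - (vn (i + 1) * p (x (i + 1)) - vn i * p (x i)) := by
    intro i hi
    have hi := Finset.mem_range.1 hi
    have hlt := hx.2.2.2 i hi
    have hle := hlt.le
    have hsub := wf_subset hx hi
    have hFi := hF.mono hsub
    have hq1 : (q i).eval (x (i + 1)) = p (x (i + 1)) := by
      have h1 := wf_ftc (right_mem_Icc.2 hle) (fun y hy => (hp y (hsub hy)).mono hsub) hFi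
      have h2 := (hP i hi).2 1 (by
        exact Polynomial.degree_one_le.trans (by exact_mod_cast Nat.zero_le _))
      simp only [Polynomial.eval_one, mul_one] at h2
      rw [intervalIntegral.integral_sub (wf_ii hle hFi) (wf_ii hle (wf_pc _ _))] at h2
      have h3 := wf_parts (q i) 1 (x i) (x (i + 1))
      simp only [hq i hi, Polynomial.eval_one, Polynomial.derivative_one, Polynomial.eval_zero,
        mul_zero, mul_one, intervalIntegral.integral_zero, hqx i hi] at h3
      linarith
    have h1 : (∫ t in x i..x (i + 1), f t * (v0 i).eval t)
        = -∫ t in x i..x (i + 1), F t * (v0 i).eval t := by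
      rw [← intervalIntegral.integral_neg]
      refine intervalIntegral.integral_congr_Ioo_of_le hle fun t ht => ?_
      have ht' : t ∈ Ioo a b := by
        have h3 := hsub (left_mem_Icc.2 hle)
        have h4 := hsub (right_mem_Icc.2 hle)
        exact ⟨h3.1.trans_lt ht.1, ht.2.trans_le h4.2⟩
      simp only [hf t ht', neg_mul]
    have h2 := (hP i hi).2 (v0 i) (hv0 i hi).1
    simp only [sub_mul] at h2
    rw [intervalIntegral.integral_sub (wf_iim hle hFi (wf_pc _ _))
      (wf_iim hle (wf_pc _ _) (wf_pc _ _))] at h2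
    have h3 := (hDv i hi).2 (q i) (hqd i hi)
    rw [hq i hi, hq1, hqx i hi] at h3
    have h4 : (∫ t in x i..x (i + 1), (v0 i).eval t * (P i).eval t)
      = ∫ t in x i..x (i + 1), (P i).eval t * (v0 i).eval t := by
      congr 1; ext t; ring
    rw [h1, h3]
    linarith
  rw [Finset.sum_congr rfl hloc, Finset.sum_sub_distrib,
    Finset.sum_range_sub (fun i => vn i * p (x i)), hx.2.2.1, hpb] at hmain
  have hv00 : vn 0 = 0 := by simp [vn]
  rw [hv00] at hmain
  have hsplit : ∀ i ∈ Finset.range (N - 1), (∫ t in x i..x (i + 1),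
      (a2 t * (Du i).eval t - (q i).eval t) * (g i).eval t)
      = (∫ t in x i..x (i + 1), a2 t * (Du i).eval t * (g i).eval t)
        - ∫ t in x i..x (i + 1), (g i).eval t * (q i).eval t := by
    intro i hi
    have hi := Finset.mem_range.1 hi
    have hle := (hx.2.2.2 i hi).le
    have hai := ha2.mono (wf_subset hx hi)
    rw [← intervalIntegral.integral_sub (wf_iim hle
      (f := fun t => a2 t * (Du i).eval t) (hai.mul (wf_pc _ _)) (wf_pc _ _))
      (wf_iim hle (wf_pc _ _) (wf_pc _ _))]
    congr 1; ext t; ring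
  rw [Finset.sum_congr rfl hsplit, Finset.sum_sub_distrib, hmain]
  ring

lemma wf_iter {n : ℕ} {a b : ℝ} (hab : a < b) {w : ℝ → ℝ} (hw : ContDiffOn ℝ n w (Icc a b))
    {m : ℕ} (hm : m < n) : ∀ y ∈ Icc a b, HasDerivWithinAt (iteratedDerivWithin m w (Icc a b))
      (iteratedDerivWithin (m + 1) w (Icc a b) y) (Icc a b) y := by
  intro y hy
  rw [iteratedDerivWithin_succ]
  exact (hw.differentiableOn_iteratedDerivWithin (by exact_mod_cast hm)
    (uniqueDiffOn_Icc hab) y hy).hasDerivWithinAt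

lemma wf_bound {a b : ℝ} {g : ℝ → ℝ} (hg : ContinuousOn g (Icc a b)) :
    ∃ K : ℝ, 0 ≤ K ∧ ∀ t ∈ Icc a b, |g t| ≤ K := by
  obtain ⟨K, hK⟩ := isCompact_Icc.exists_bound_of_continuousOn hg
  exact ⟨max K 0, le_max_right _ _, fun t ht => (hK t ht).trans (le_max_left _ _)⟩

/-- Leibniz bound. -/
lemma wf_leibniz (k : ℕ) {a b : ℝ} (hab : a < b) {a2 : ℝ → ℝ}
    (ha2 : ContDiffOn ℝ ((k + 2 : ℕ) : WithTop ℕ∞) a2 (Icc a b)) :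
    ∃ B : ℝ, 0 ≤ B ∧ ∀ u : ℝ → ℝ, ContDiffOn ℝ ((k + 3 : ℕ) : WithTop ℕ∞) u (Icc a b) →
      ∀ t ∈ Icc a b,
      |iteratedDerivWithin (k + 2) (fun t => a2 t * derivWithin u (Icc a b) t) (Icc a b) t|
        ≤ B * ∑ m ∈ Finset.range (k + 4), |iteratedDerivWithin m u (Icc a b) t| := by
  have hU := uniqueDiffOn_Icc hab
  have hK : ∀ i, ∃ K : ℝ, 0 ≤ K ∧ (i ≤ k + 2 →
      ∀ t ∈ Icc a b, |iteratedDerivWithin i a2 (Icc a b) t| ≤ K) := by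
    intro i
    by_cases hi : i ≤ k + 2
    · obtain ⟨K, h0, h1⟩ := wf_bound (ha2.continuousOn_iteratedDerivWithin
        (by exact_mod_cast hi) hU)
      exact ⟨K, h0, fun _ => h1⟩
    · exact ⟨0, le_rfl, fun h => absurd h hi⟩
  choose K hK0 hK1 using hK
  refine ⟨∑ i ∈ Finset.range (k + 2 + 1), ((k + 2).choose i : ℝ) * K i,
    Finset.sum_nonneg fun i _ => mul_nonneg (Nat.cast_nonneg _) (hK0 i), fun u hu t ht => ?_⟩
  have hu' : ContDiffOn ℝ ((k + 2 : ℕ) : WithTop ℕ∞) (derivWithin u (Icc a b)) (Icc a b) :=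
    hu.derivWithin hU (by norm_cast)
  have h1 := iteratedDerivWithin_mul ht hU (ha2 t ht) (hu' t ht)
  have h2 : (fun t => a2 t * derivWithin u (Icc a b) t) = a2 * derivWithin u (Icc a b) := rfl
  rw [h2, h1, Finset.sum_mul]
  refine (Finset.abs_sum_le_sum_abs _ _).trans (Finset.sum_le_sum fun i hi => ?_)
  have hi := Finset.mem_range.1 hi
  rw [abs_mul, abs_mul, Nat.abs_cast, ← iteratedDerivWithin_succ']
  have h3 : |iteratedDerivWithin (k + 2 - i + 1) u (Icc a b) t|
      ≤ ∑ m ∈ Finset.range (k + 4), |iteratedDerivWithin m u (Icc a b) t| :=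
    Finset.single_le_sum (f := fun m => |iteratedDerivWithin m u (Icc a b) t|)
      (fun _ _ => abs_nonneg _) (Finset.mem_range.2 (by omega))
  have h4 := hK1 i (by omega) t ht
  have h5 := hK0 i
  gcongr

lemma wf_sob (m : ℕ) {a b : ℝ} (hab : a < b) {u : ℝ → ℝ}
    (hu : ∀ j < m + 1, ContinuousOn (iteratedDerivWithin j u (Icc a b)) (Icc a b)) :
    ∫ t in a..b, ∑ j ∈ Finset.range (m + 1), |iteratedDerivWithin j u (Icc a b) t|
      ≤ ((m + 1 : ℕ) : ℝ) * Real.sqrt (b - a) * sobNorm m a b u := by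
  rw [intervalIntegral.integral_finsetSum
    (fun j hj => wf_ii hab.le (hu j (Finset.mem_range.1 hj)).abs)]
  have : ∀ j ∈ Finset.range (m + 1), (∫ t in a..b, |iteratedDerivWithin j u (Icc a b) t|)
      ≤ Real.sqrt (b - a) * sobNorm m a b u := by
    intro j hj
    have h1 := wf_cs hab (hu j (Finset.mem_range.1 hj))
    refine (Real.le_sqrt_of_sq_le h1).trans ?_
    rw [Real.sqrt_mul (sub_pos.2 hab).le]
    unfold sobNorm
    gcongr
    exact Finset.single_le_sum (f := fun j => ∫ t in a..b, (iteratedDerivWithin j u (Icc a b) t) ^ 2)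
      (fun _ _ => intervalIntegral.integral_nonneg hab.le fun _ _ => sq_nonneg _) hj
  refine (Finset.sum_le_card_nsmul _ _ _ this).trans ?_
  rw [Finset.card_range, nsmul_eq_mul, mul_assoc]

end Helpers2

/-- Theorem 4.4, superconvergence (4.19). Let `k ≥ 0`, `r = k + 1`,
`a0 ≡ 0`, and `a2 ∈ C^{k+2}([a,b])` with `a2 ≥ a_min > 0`. There is a constant `C > 0`
independent of the partition such that for every partition with mesh size `h`, if
`u ∈ C^{k+3}([a,b])` solves `-(a2 u')' = f` on `(a,b)` with `u(a) = 0`, `u'(b) = 0`, and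
`u_h ∈ S_h` is the weak finite element solution with nodal values `un`, then
`max_{1 ≤ i ≤ N} |u_h^i − u(x_i)| ≤ C h^{k+2} ‖u‖_{k+3}`. -/
theorem superconvergence_nodal (k : ℕ) (a b amin : ℝ) (hab : a < b) (hamin : 0 < amin)
    (a2 : ℝ → ℝ)
    (ha2 : ContDiffOn ℝ (k + 2) a2 (Set.Icc a b)) (ha2lb : ∀ t ∈ Set.Icc a b, amin ≤ a2 t) :
    ∃ C > (0 : ℝ), ∀ (N : ℕ) (x : ℕ → ℝ), IsPartition N a b x →
      ∀ h : ℝ, (∀ i < N - 1, x (i + 1) - x i ≤ h) →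
      ∀ f u : ℝ → ℝ, ContDiffOn ℝ (k + 3) u (Set.Icc a b) →
        SolvesBVP a b a2 (fun _ => 0) f u →
      ∀ (u0 : ℕ → Polynomial ℝ) (un : ℕ → ℝ) (Du : ℕ → Polynomial ℝ),
        IsWFESol k (k + 1) N x a2 (fun _ => 0) f u0 un Du →
        ∀ i < N, |un i - u (x i)| ≤ C * h ^ (k + 2) * sobNorm (k + 3) a b u := by
  have hU := uniqueDiffOn_Icc hab
  have ha2' : ContDiffOn ℝ ((k + 2 : ℕ) : WithTop ℕ∞) a2 (Icc a b) := by exact_mod_cast ha2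
  obtain ⟨B, hB, hleib⟩ := wf_leibniz k hab ha2'
  obtain ⟨A, hA, hAb⟩ := wf_bound ha2.continuousOn
  have hsq : 0 < Real.sqrt (b - a) := Real.sqrt_pos.2 (sub_pos.2 hab)
  refine ⟨((B + A) / amin + 1) * (((k + 3 + 1 : ℕ) : ℝ) * Real.sqrt (b - a)), by positivity, ?_⟩
  intro N x hx h hh f u hu hbvp u0 un Du hsol i hi
  have hu3 : ContDiffOn ℝ ((k + 3 : ℕ) : WithTop ℕ∞) u (Icc a b) := by exact_mod_cast hu
  -- the flux
  let w : ℝ → ℝ := derivWithin u (Icc a b)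
  let p : ℝ → ℝ := fun t => a2 t * w t
  let Dk : ℕ → ℝ → ℝ := fun m => iteratedDerivWithin m u (Icc a b)
  let Pk : ℕ → ℝ → ℝ := fun m => iteratedDerivWithin m p (Icc a b)
  let G : ℝ → ℝ := fun t => ∑ m ∈ Finset.range (k + 3 + 1), |Dk m t|
  have hw : ContDiffOn ℝ ((k + 2 : ℕ) : WithTop ℕ∞) w (Icc a b) :=
    hu3.derivWithin hU (by norm_cast)
  have hp : ContDiffOn ℝ ((k + 2 : ℕ) : WithTop ℕ∞) p (Icc a b) := ha2'.mul hw
  have hD0 : Dk 0 = u := iteratedDerivWithin_zero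
  have hD1 : Dk 1 = w := by
    change iteratedDerivWithin (0 + 1) u (Icc a b) = _
    rw [iteratedDerivWithin_succ, iteratedDerivWithin_zero]
  have hP0 : Pk 0 = p := iteratedDerivWithin_zero
  have hP1 : Pk 1 = derivWithin p (Icc a b) := by
    change iteratedDerivWithin (0 + 1) p (Icc a b) = _
    rw [iteratedDerivWithin_succ, iteratedDerivWithin_zero]
  have hDc : ∀ m, m < k + 3 + 1 → ContinuousOn (Dk m) (Icc a b) := fun m hm =>
    hu3.continuousOn_iteratedDerivWithin (by exact_mod_cast Nat.lt_succ_iff.1 hm) hU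
  have hPc : ∀ m, m ≤ k + 2 → ContinuousOn (Pk m) (Icc a b) := fun m hm =>
    hp.continuousOn_iteratedDerivWithin (by exact_mod_cast hm) hU
  have hGc : ContinuousOn G (Icc a b) :=
    continuousOn_finset_sum _ fun m hm => (hDc m (Finset.mem_range.1 hm)).abs
  have hG0 : ∀ t, 0 ≤ G t := fun t => Finset.sum_nonneg fun _ _ => abs_nonneg _
  have hpd : ∀ y ∈ Icc a b, HasDerivWithinAt p (Pk 1 y) (Icc a b) y := by
    intro y hy
    have := wf_iter hab hp (m := 0) (by omega) y hy
    rwa [iteratedDerivWithin_zero] at this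
  have hud : ∀ y ∈ Icc a b, HasDerivWithinAt u (w y) (Icc a b) y := by
    intro y hy
    have := wf_iter hab hu3 (m := 0) (by omega) y hy
    rw [iteratedDerivWithin_zero] at this
    rw [← hD1]
    exact this
  have hwc : ContinuousOn w (Icc a b) := hw.continuousOn
  -- projections of the flux
  have hex : ∀ j, ∃ P q : Polynomial ℝ, j < N - 1 →
      IsL2Proj k (x j) (x (j + 1)) (Pk 1) P ∧ q.degree ≤ ((k + 1 : ℕ) : WithBot ℕ) ∧
      q.derivative = P ∧ q.eval (x j) = p (x j) := by
    intro j
    by_cases hj : j < N - 1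
    · obtain ⟨P, hP⟩ := wf_exists_proj k (hx.2.2.2 j hj)
        ((hPc 1 (by omega)).mono (wf_subset hx hj))
      obtain ⟨q, h1, h2, h3⟩ := wf_antideriv k P hP.1 (x j) (p (x j))
      exact ⟨P, q, fun _ => ⟨hP, h1, h2, h3⟩⟩
    · exact ⟨0, 0, fun h => absurd h hj⟩
  choose P q hPq using hex
  have hf : ∀ y ∈ Ioo a b, f y = -(Pk 1 y) := by
    intro y hy
    have := hbvp.1 y hy
    rw [hP1, ← this]
    simp [p, w]
  have hpb : p b = 0 := by
    change a2 b * derivWithin u (Icc a b) b = 0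
    rw [hbvp.2.2, mul_zero]
  have horth := wf_orth hx ha2.continuousOn hpd (hPc 1 (by omega)) hf hpb hsol
    (fun j hj => (hPq j hj).1) (fun j hj => (hPq j hj).2.1) (fun j hj => (hPq j hj).2.2.1)
    (fun j hj => (hPq j hj).2.2.2)
  -- local estimates
  have hlocal : ∀ j < N - 1, |∫ t in x j..x (j + 1), ((Du j).eval t - w t)|
      ≤ ((B + A) / amin + 1) * h ^ (k + 2) * ∫ t in x j..x (j + 1), G t := by
    intro j hj
    have hlt := hx.2.2.2 j hj
    have hle := hlt.le
    have hH : 0 < x (j + 1) - x j := sub_pos.2 hlt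
    have hsub := wf_subset hx hj
    set I := ∫ t in x j..x (j + 1), G t with hI
    have hI0 : 0 ≤ I := intervalIntegral.integral_nonneg hle fun t _ => hG0 t
    have hGi := wf_ii hle (hGc.mono hsub)
    obtain ⟨s, hsd, hs⟩ := wf_taylor hlt (k + 1) (fun m => Dk (m + 1))
      (fun m hm y hy => (wf_iter hab hu3 (m := m + 1) (by omega) y (hsub hy)).mono hsub)
      ((hDc _ (by omega)).mono hsub)
    obtain ⟨T, hTd, hT⟩ := wf_taylor hlt k (fun m => Pk (m + 1))
      (fun m hm y hy => (wf_iter hab hp (m := m + 1) (by omega) y (hsub hy)).mono hsub)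
      ((hPc _ (by omega)).mono hsub)
    have hsI : (∫ y in x j..x (j + 1), |Dk (k + 1 + 1 + 1) y|) ≤ I := by
      refine intervalIntegral.integral_mono_on hle
        (wf_ii hle ((hDc _ (by omega)).mono hsub).abs) hGi fun t ht => ?_
      exact Finset.single_le_sum (f := fun m => |Dk m t|)
        (fun _ _ => abs_nonneg _) (Finset.mem_range.2 (by omega))
    have hTI : (∫ y in x j..x (j + 1), |Pk (k + 1 + 1) y|) ≤ B * I := by
      rw [hI, ← intervalIntegral.integral_const_mul]
      refine intervalIntegral.integral_mono_on hle
        (wf_ii hle ((hPc _ (by omega)).mono hsub).abs) (hGi.const_mul B) fun t ht => ?_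
      exact hleib u hu3 t (hsub ht)
    have hflux := wf_flux hlt k p (Pk 1) (P j) (q j) T
      (M := (x (j + 1) - x j) ^ k * (B * I))
      (fun y hy => (hpd y (hsub hy)).mono hsub) ((hPc 1 (by omega)).mono hsub)
      (hPq j hj).1 (hPq j hj).2.2.1 (hPq j hj).2.2.2 hTd (by positivity)
      (fun t ht => (hT t ht).trans (by gcongr))
    have ho : ∫ t in x j..x (j + 1),
        (a2 t * (Du j).eval t - (q j).eval t) * (Du j - s).eval t = 0 := by
      have h1 := horth (fun l => if l = j then Du j - s else 0) (by
        intro l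
        split_ifs
        · exact (Polynomial.degree_sub_le _ _).trans (max_le (hsol.2.1 j hj).1 hsd)
        · simp)
      rw [Finset.sum_eq_single j] at h1
      · simpa only [if_true] using h1
      · intro l _ hl
        simp [hl]
      · intro hn
        exact absurd (Finset.mem_range.2 hj) hn
    have hs' : ∀ t ∈ Icc (x j) (x (j + 1)), |w t - s.eval t|
        ≤ (x (j + 1) - x j) ^ (k + 1) * I := by
      intro t ht
      have h1 := hs t ht
      simp only [zero_add, hD1] at h1
      exact h1.trans (by gcongr)
    have hfin := wf_local hlt hamin a2 w (Du j) s (q j) (ha2.continuousOn.mono hsub)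
      (hwc.mono hsub) (fun t ht => ha2lb t (hsub ht))
      (fun t ht => (le_abs_self _).trans (hAb t (hsub ht)))
      (by positivity) (by positivity) hflux hs' ho
    refine hfin.trans ?_
    have e1 : (x (j + 1) - x j) * (((x (j + 1) - x j) * ((x (j + 1) - x j) ^ k * (B * I))
        + A * ((x (j + 1) - x j) ^ (k + 1) * I)) / amin + (x (j + 1) - x j) ^ (k + 1) * I)
        = ((B + A) / amin + 1) * (x (j + 1) - x j) ^ (k + 2) * I := by
      field_simp; ring
    rw [e1]
    have := hh j hj
    gcongr
  -- summation
  have hh0 : 0 ≤ h := by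
    have h1 := hx.1
    have h2 := hx.2.2.2 0 (by omega)
    have h3 := hh 0 (by omega)
    linarith
  have herr : ∀ n ≤ N - 1, un n - u (x n)
      = ∑ j ∈ Finset.range n, ∫ t in x j..x (j + 1), ((Du j).eval t - w t) := by
    intro n hn
    have h0 : un 0 - u (x 0) = 0 := by rw [hsol.1.2, hx.2.1, hbvp.2.1, sub_zero]
    have h1 := Finset.sum_range_sub (fun j => un j - u (x j)) n
    rw [h0, sub_zero] at h1
    rw [← h1]
    refine Finset.sum_congr rfl fun j hj => ?_
    have hj : j < N - 1 := (Finset.mem_range.1 hj).trans_le hn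
    have hle := (hx.2.2.2 j hj).le
    have hsub := wf_subset hx hj
    have h2 := (hsol.2.1 j hj).2 1 (by
      exact Polynomial.degree_one_le.trans (by exact_mod_cast Nat.zero_le _))
    simp only [Polynomial.eval_one, Polynomial.derivative_one, Polynomial.eval_zero, mul_zero,
      mul_one, intervalIntegral.integral_zero] at h2
    have h3 := wf_ftc (right_mem_Icc.2 hle) (fun y hy => (hud y (hsub hy)).mono hsub)
      (hwc.mono hsub)
    rw [intervalIntegral.integral_sub (wf_ii hle (wf_pc _ _)) (wf_ii hle (hwc.mono hsub)), h2, h3]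
    ring
  have hiN : i ≤ N - 1 := by omega
  have hGsum : ∑ j ∈ Finset.range (N - 1), ∫ t in x j..x (j + 1), G t = ∫ t in a..b, G t := by
    rw [intervalIntegral.sum_integral_adjacent_intervals, hx.2.1, hx.2.2.1]
    intro j hj
    exact wf_ii (hx.2.2.2 j hj).le (hGc.mono (wf_subset hx hj))
  have hsob : ∫ t in a..b, G t
      ≤ ((k + 3 + 1 : ℕ) : ℝ) * Real.sqrt (b - a) * sobNorm (k + 3) a b u :=
    wf_sob (k + 3) hab hDc
  rw [herr i hiN]
  calc |∑ j ∈ Finset.range i, ∫ t in x j..x (j + 1), ((Du j).eval t - w t)|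
      ≤ ∑ j ∈ Finset.range i, |∫ t in x j..x (j + 1), ((Du j).eval t - w t)| :=
        Finset.abs_sum_le_sum_abs _ _
    _ ≤ ∑ j ∈ Finset.range (N - 1), |∫ t in x j..x (j + 1), ((Du j).eval t - w t)| :=
        Finset.sum_le_sum_of_subset_of_nonneg (Finset.range_mono hiN) fun _ _ _ => abs_nonneg _
    _ ≤ ∑ j ∈ Finset.range (N - 1),
          ((B + A) / amin + 1) * h ^ (k + 2) * ∫ t in x j..x (j + 1), G t :=
        Finset.sum_le_sum fun j hj => hlocal j (Finset.mem_range.1 hj)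
    _ = ((B + A) / amin + 1) * h ^ (k + 2) * ∫ t in a..b, G t := by
        rw [← Finset.mul_sum, hGsum]
    _ ≤ ((B + A) / amin + 1) * h ^ (k + 2)
          * (((k + 3 + 1 : ℕ) : ℝ) * Real.sqrt (b - a) * sobNorm (k + 3) a b u) := by
        gcongr
    _ = _ := by ring
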